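/- (Expander mixing lemma.) Let G be a d-regular simple graph on a finite vertex set V with |V| = n, let A be its adjacency matrix, and suppose λ ≥ 0 is such that ‖A v‖ ≤ λ‖v‖ for every real vector v indexed by V whose coordinates sum to 0. Then for all subsets B, C ⊆ V, |e(B, C) − (d/n)·|B|·|C|| ≤ λ·√(|B|·|C|), where e(B, C) is the number of ordered pairs (u, v) with u ∈ B, v ∈ C, and u adjacent to v in G. -/

import Mathlib

open Finset
open scoped Classical

/-- Applying the adjacency matrix of a `d`-regular graph to the indicator of `C` minus a constant `c`
and summing over `B` counts the ordered adjacent pairs in `B × C`, minus `c * d * |B|`. -/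
lemma sum_adjMatrix_mulVec_indicator_sub_const {V : Type*} [Fintype V] {d : ℕ}
    (G : SimpleGraph V) (hreg : G.IsRegularOfDegree d) (B C : Finset V) (c : ℝ) :
    ∑ x ∈ B, (G.adjMatrix ℝ).mulVec (fun y => (if y ∈ C then 1 else 0) - c) x =
      (((B ×ˢ C).filter (fun p : V × V => G.Adj p.1 p.2)).card : ℝ) - c * d * B.card := by
  have hcard : (((B ×ˢ C).filter (fun p : V × V => G.Adj p.1 p.2)).card : ℝ) =
      ∑ x ∈ B, ∑ y ∈ G.neighborFinset x, if y ∈ C then (1 : ℝ) else 0 := by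
    rw [card_filter, Nat.cast_sum, sum_product]
    refine sum_congr rfl fun x _ => ?_
    simp only [Nat.cast_ite, Nat.cast_one, Nat.cast_zero, sum_boole]
    congr 2
    ext y
    simp [and_comm]
  simp only [SimpleGraph.adjMatrix_mulVec_apply, sum_sub_distrib, sum_const,
    SimpleGraph.card_neighborFinset_eq_degree, hreg.degree_eq, nsmul_eq_mul, hcard]
  ring

/-- Expander mixing lemma: Let `G` be a `d`-regular simple graph on `n`
vertices whose adjacency matrix `A` satisfies `‖A v‖ ≤ λ ‖v‖` for every real vector `v`
with coordinates summing to `0`. Then for all vertex subsets `B, C`,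
`|e(B,C) - (d/n)|B||C|| ≤ λ √(|B||C|)`, where `e(B,C)` counts ordered adjacent pairs. -/
theorem expander_mixing_lemma (V : Type) [Fintype V] (n d : ℕ)
    (hn : Fintype.card V = n)
    (G : SimpleGraph V) (hreg : G.IsRegularOfDegree d)
    (lam : ℝ) (hlam : 0 ≤ lam)
    (hexp : ∀ v : V → ℝ, ∑ x, v x = 0 →
      Real.sqrt (∑ x, ((G.adjMatrix ℝ).mulVec v x) ^ 2)
        ≤ lam * Real.sqrt (∑ x, (v x) ^ 2))
    (B C : Finset V) :
    |(((B ×ˢ C).filter (fun p : V × V => G.Adj p.1 p.2)).card : ℝ)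
        - (d : ℝ) / n * B.card * C.card|
      ≤ lam * Real.sqrt ((B.card : ℝ) * C.card) := by
  have key := sum_adjMatrix_mulVec_indicator_sub_const G hreg B C ((C.card : ℝ) / n)
  set v : V → ℝ := fun y => (if y ∈ C then 1 else 0) - (C.card : ℝ) / n with hv
  have hmean : (n : ℝ) * ((C.card : ℝ) / n) = C.card := by
    rcases Nat.eq_zero_or_pos n with h | h
    · have : C.card = 0 := Nat.le_zero.mp (by simpa [hn, h] using C.card_le_univ)
      simp [this]
    · field_simp
  have hsum : ∑ x, v x = 0 := by
    simp [hv, hn, hmean]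
  have hnorm : ∑ x, v x ^ 2 ≤ C.card := by
    have hsq : ∀ x, v x ^ 2 = (if x ∈ C then 1 else 0) - (C.card : ℝ) / n * (if x ∈ C then 1 else 0)
        - (C.card : ℝ) / n * v x := by
      intro x
      by_cases hx : x ∈ C <;> simp [hv, hx] <;> ring
    simp only [hsq, sum_sub_distrib, ← mul_sum, hsum]
    simp only [sum_boole, filter_univ_mem, mul_zero, sub_zero, sub_le_self_iff]
    positivity
  have hcs : |∑ x ∈ B, (G.adjMatrix ℝ).mulVec v x| ≤
      √(B.card : ℝ) * √(∑ x, ((G.adjMatrix ℝ).mulVec v x) ^ 2) := by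
    rw [← Real.sqrt_mul (Nat.cast_nonneg _)]
    refine Real.abs_le_sqrt (sq_sum_le_card_mul_sum_sq.trans ?_)
    gcongr
    exact subset_univ B
  calc _ = |∑ x ∈ B, (G.adjMatrix ℝ).mulVec v x| := by
        rw [key]
        congr 1
        ring
    _ ≤ √(B.card : ℝ) * (lam * √(C.card : ℝ)) := by
        refine hcs.trans ?_
        gcongr
        refine (hexp v hsum).trans ?_
        gcongr
    _ = lam * √((B.card : ℝ) * C.card) := by
        rw [Real.sqrt_mul (Nat.cast_nonneg _)]
        ring
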